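/- Let m, n ≥ 1, let S : 𝒫(m)^n → 𝒫(m)^n be a map with components S_1,…,S_n, let H be a subgroup of S_n, and let τ : H → H be a map such that S(Ah) = S(A)τ(h) for all A ∈ 𝒫(m)^n and all h ∈ H. Then for each i ∈ {1,…,n}, the set H_i := {h ∈ H : S_i(Ah) = S_i(A) for all A ∈ 𝒫(m)^n} is a subgroup of H whose index in H is at most n. -/

import Mathlib

open scoped ComplexOrder
open Matrix

namespace PaperMeans

/-- Square complex matrices of size `m`. -/
abbrev Mat (m : ℕ) := Matrix (Fin m) (Fin m) ℂ

/-- `𝒫(m)`: the Hermitian positive definite `m × m` complex matrices. -/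
abbrev PD (m : ℕ) := { A : Mat m // A.PosDef }

/-- if `S : 𝒫(m)ⁿ → 𝒫(m)ⁿ` satisfies `S(Ah) = S(A)τ(h)` for a subgroup `H ≤ Sₙ`
and a map `τ : H → H`, then for every `i` the set
`Hᵢ = {h ∈ H : Sᵢ(Ah) = Sᵢ(A) for all A}` is a subgroup of `H` of index at most `n`. -/
theorem stmt7 (m n : ℕ) (hm : 1 ≤ m) (hn : 1 ≤ n)
    (S : (Fin n → PD m) → (Fin n → PD m))
    (H : Subgroup (Equiv.Perm (Fin n))) (τ : H → H)
    (hS : ∀ (A : Fin n → PD m) (h : H),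
      S (fun j => A ((h : Equiv.Perm (Fin n)) j)) =
        fun i => S A (((τ h : H) : Equiv.Perm (Fin n)) i)) :
    ∀ i : Fin n, ∃ K : Subgroup H,
      (∀ h : H, h ∈ K ↔
        ∀ A : Fin n → PD m, S (fun j => A ((h : Equiv.Perm (Fin n)) j)) i = S A i) ∧
      K.index ≤ n := by
  intro i
  let K : Subgroup H :=
    { carrier := {h | ∀ A : Fin n → PD m,
        S (fun j => A ((h : Equiv.Perm (Fin n)) j)) i = S A i}
      mul_mem' := fun {g h} hg hh A =>
        (hh fun j => A ((g : Equiv.Perm (Fin n)) j)).trans (hg A)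
      one_mem' := fun _ => rfl
      inv_mem' := fun {h} hh A => by
        simpa using (hh fun j => A (((h⁻¹ : H) : Equiv.Perm (Fin n)) j)).symm }
  refine ⟨K, fun _ => Iff.rfl, ?_⟩
  have hinj : Function.Injective
      fun q : H ⧸ K => ((τ q.out : H) : Equiv.Perm (Fin n)) i := by
    intro p q hpq
    rw [← p.out_eq', ← q.out_eq', QuotientGroup.eq]
    intro A
    let B : Fin n → PD m := fun j => A (((p.out⁻¹ : H) : Equiv.Perm (Fin n)) j)
    have hp := congrFun (hS B p.out) i
    have hq := congrFun (hS B q.out) i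
    have hB : (fun j => B ((p.out : Equiv.Perm (Fin n)) j)) = A := by
      funext j
      simp [B]
    rw [hB] at hp
    exact hq.trans ((congrArg (S B) hpq).symm.trans hp.symm)
  simpa [Subgroup.index] using Nat.card_le_card_of_injective _ hinj

end PaperMeans
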